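/- Under the hypotheses of the gluing lemma (Lemma 4.3, n = 2 case): a₁ < b₁ < a₂ < b₂ real, Q₁, Q₂, Q ∈ ℝ with Q² ≤ min(Q₁², Q₂²), f₁ : [a₁,b₁] → ℝ and f₂ : [a₂,b₂] → ℝ smooth positive with fᵢ'' < (1/(2fᵢ))(1 − (fᵢ')² − Qᵢ²/fᵢ²) on their domains, f₁(b₁) < f₂(a₂), f₂'(a₂) ≤ f₁'(b₁), f₁(b₁) > |Q₁|, 1 + Q₁²/f₁(b₁)² − 2|Q₁|/f₁(b₁) > f₁'(b₁)², f₂(a₂) > |Q₂|, 1 + Q₂²/f₂(a₂)² − 2|Q₂|/f₂(a₂) > f₂'(a₂)², with the translation condition ((a₂−b₁)f₁'(b₁) = f₂(a₂)−f₁(b₁) if f₁'(b₁) = f₂'(a₂), and (a₂−b₁)f₂'(a₂) < f₂(a₂)−f₁(b₁) < (a₂−b₁)f₁'(b₁) otherwise), assume in addition that f₁' > 0 on [a₁,b₁] and f₂' > 0 on [a₂,b₂]. Then the bridging function f : [a₁,b₂] → ℝ can be chosen smooth and positive with f ≡ f₁ on [a₁,(a₁+b₁)/2], f ≡ f₂ on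 [(a₂+b₂)/2, b₂], f'' < (1/(2f))(1 − (f')² − Q²/f²) on [a₁,b₂], and moreover f' > 0 on [a₁,b₂]. -/

import Mathlib

open Set Filter Topology

/-- Right-hand side of the charged DEC inequality. -/
noncomputable def RR (Q y0 y1 : ℝ) : ℝ := (1 / (2 * y0)) * (1 - y1 ^ 2 - Q ^ 2 / y0 ^ 2)

/-- Polynomial form of the inequality. -/
def PP (Q y0 y1 y2 : ℝ) : ℝ := 2 * y0 ^ 3 * y2 + y0 ^ 2 * y1 ^ 2 + Q ^ 2 - y0 ^ 2

lemma RR_sub (Q y0 y1 y2 : ℝ) (h : 0 < y0) :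
    PP Q y0 y1 y2 = 2 * y0 ^ 3 * (y2 - RR Q y0 y1) := by
  unfold PP RR
  field_simp
  ring

lemma lt_RR_iff (Q y0 y1 y2 : ℝ) (h : 0 < y0) : y2 < RR Q y0 y1 ↔ PP Q y0 y1 y2 < 0 := by
  rw [RR_sub Q y0 y1 y2 h]
  have : 0 < 2 * y0 ^ 3 := by positivity
  constructor
  · intro h'
    exact mul_neg_of_pos_of_neg this (by linarith)
  · intro h'
    by_contra hc
    have := mul_nonneg this.le (sub_nonneg.2 (not_lt.1 hc))
    linarith

lemma contAt_RR (Q y0 y1 : ℝ) (h : 0 < y0) :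
    ContinuousAt (fun p : ℝ × ℝ => RR Q p.1 p.2) (y0, y1) := by
  unfold RR
  have h1 : 2 * (y0, y1).1 ≠ 0 := by simp; exact h.ne'
  have h2 : (y0, y1).1 ^ 2 ≠ 0 := by simp; exact h.ne'
  fun_prop (disch := assumption)

/-- The perturbation lemma on continuous data. -/
lemma perturb_aux (c b Q σ : ℝ) (y0 y1 y2 z0 z1 z2 : ℝ → ℝ)
    (hy0 : Continuous y0) (hy1 : Continuous y1) (hy2 : Continuous y2)
    (hz0 : Continuous z0) (hz1 : Continuous z1) (hz2 : Continuous z2)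
    (hpos : ∀ s ∈ Icc c b, 0 < y0 s) (hσ : ∀ s ∈ Icc c b, 0 < σ * y1 s)
    (hP : ∀ s ∈ Icc c b, s ≠ b → PP Q (y0 s) (y1 s) (y2 s) < 0)
    (hPb : ∀ s ∈ Icc c b, PP Q (y0 s) (y1 s) (y2 s) ≤ 0)
    (e0 : z0 b = 0) (e1 : z1 b = 0) (e2 : z2 b < 0) :
    ∃ ε > 0, ∀ s ∈ Icc c b, 0 < y0 s + ε * z0 s ∧ 0 < σ * (y1 s + ε * z1 s) ∧
      PP Q (y0 s + ε * z0 s) (y1 s + ε * z1 s) (y2 s + ε * z2 s) < 0 := by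
  have key : ∀ᶠ ε : ℝ in 𝓝 0, ∀ s ∈ Icc c b, 0 < ε → s ∈ Icc c b →
      0 < y0 s + ε * z0 s ∧ 0 < σ * (y1 s + ε * z1 s) ∧
      PP Q (y0 s + ε * z0 s) (y1 s + ε * z1 s) (y2 s + ε * z2 s) < 0 := by
    apply isCompact_Icc.eventually_forall_of_forall_eventually
    intro s hs
    have c0 : Continuous (fun p : ℝ × ℝ => y0 p.2 + p.1 * z0 p.2) := by fun_prop
    have c1 : Continuous (fun p : ℝ × ℝ => σ * (y1 p.2 + p.1 * z1 p.2)) := by fun_prop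
    have c2 : Continuous (fun p : ℝ × ℝ => PP Q (y0 p.2 + p.1 * z0 p.2)
        (y1 p.2 + p.1 * z1 p.2) (y2 p.2 + p.1 * z2 p.2)) := by unfold PP; fun_prop
    have E0 := c0.continuousAt (x := ((0:ℝ), s)) |>.eventually_const_lt (u := 0)
      (by simpa using hpos s hs)
    have E1 := c1.continuousAt (x := ((0:ℝ), s)) |>.eventually_const_lt (u := 0)
      (by simpa using hσ s hs)
    by_cases hsb : s = b
    · subst hsb
      have c3 : Continuous (fun p : ℝ × ℝ =>
        2 * ((y0 p.2 + p.1 * z0 p.2) ^ 3 * z2 p.2 + z0 p.2 * ((y0 p.2 + p.1 * z0 p.2) ^ 2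
          + (y0 p.2 + p.1 * z0 p.2) * y0 p.2 + y0 p.2 ^ 2) * y2 p.2)
        + ((y0 p.2 + p.1 * z0 p.2) * (y1 p.2 + p.1 * z1 p.2) + y0 p.2 * y1 p.2)
          * ((y0 p.2 + p.1 * z0 p.2) * z1 p.2 + z0 p.2 * y1 p.2)
        - z0 p.2 * (y0 p.2 + p.1 * z0 p.2 + y0 p.2)) := by fun_prop
      have E3 := c3.continuousAt (x := ((0:ℝ), s)) |>.eventually_lt_const (u := 0)
        (by
          have := hpos s hs
          simp [e0, e1]
          have := mul_neg_of_pos_of_neg (pow_pos this 3) e2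
          linarith)
      filter_upwards [E0, E1, E3] with p h0 h1 h3 hε hp
      refine ⟨h0, h1, ?_⟩
      have h4 := hPb p.2 hp
      have h5 := mul_neg_of_pos_of_neg hε h3
      unfold PP at h4 ⊢
      nlinarith [h4, h5]
    · have E2 := c2.continuousAt (x := ((0:ℝ), s)) |>.eventually_lt_const (u := 0)
        (by simpa using hP s hs hsb)
      filter_upwards [E0, E1, E2] with p h0 h1 h2 _ _
      exact ⟨h0, h1, h2⟩
  have := (key.filter_mono nhdsWithin_le_nhds).and (self_mem_nhdsWithin (s := Ioi (0:ℝ)))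
  obtain ⟨ε, h1, h2⟩ := this.exists
  exact ⟨ε, h2, fun s hs => h1 s hs h2 hs⟩

lemma exists_cont_ext (c b : ℝ) (h : c ≤ b) (y : ℝ → ℝ) (hy : ContinuousOn y (Icc c b)) :
    ∃ Y : ℝ → ℝ, Continuous Y ∧ ∀ s ∈ Icc c b, Y s = y s := by
  refine ⟨IccExtend h ((Icc c b).domRestrict y), ?_, ?_⟩
  · exact continuous_IccExtend_iff.2 hy.domRestrict
  · intro s hs
    rw [IccExtend_of_mem h _ hs]; rfl

lemma perturb (c b Q σ : ℝ) (hcb : c ≤ b) (y0 y1 y2 z0 z1 z2 : ℝ → ℝ)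
    (hy0 : ContinuousOn y0 (Icc c b)) (hy1 : ContinuousOn y1 (Icc c b))
    (hy2 : ContinuousOn y2 (Icc c b))
    (hz0 : Continuous z0) (hz1 : Continuous z1) (hz2 : Continuous z2)
    (hpos : ∀ s ∈ Icc c b, 0 < y0 s) (hσ : ∀ s ∈ Icc c b, 0 < σ * y1 s)
    (hP : ∀ s ∈ Icc c b, s ≠ b → PP Q (y0 s) (y1 s) (y2 s) < 0)
    (hPb : ∀ s ∈ Icc c b, PP Q (y0 s) (y1 s) (y2 s) ≤ 0)
    (e0 : z0 b = 0) (e1 : z1 b = 0) (e2 : z2 b < 0) :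
    ∃ ε > 0, ∀ s ∈ Icc c b, 0 < y0 s + ε * z0 s ∧ 0 < σ * (y1 s + ε * z1 s) ∧
      PP Q (y0 s + ε * z0 s) (y1 s + ε * z1 s) (y2 s + ε * z2 s) < 0 := by
  obtain ⟨Y0, hY0, g0⟩ := exists_cont_ext c b hcb y0 hy0
  obtain ⟨Y1, hY1, g1⟩ := exists_cont_ext c b hcb y1 hy1
  obtain ⟨Y2, hY2, g2⟩ := exists_cont_ext c b hcb y2 hy2
  obtain ⟨ε, h1, h2⟩ := perturb_aux c b Q σ Y0 Y1 Y2 z0 z1 z2 hY0 hY1 hY2 hz0 hz1 hz2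
    (fun s hs => by rw [g0 s hs]; exact hpos s hs) (fun s hs => by rw [g1 s hs]; exact hσ s hs)
    (fun s hs h => by rw [g0 s hs, g1 s hs, g2 s hs]; exact hP s hs h)
    (fun s hs => by rw [g0 s hs, g1 s hs, g2 s hs]; exact hPb s hs) e0 e1 e2
  refine ⟨ε, h1, fun s hs => ?_⟩
  have := h2 s hs
  rwa [g0 s hs, g1 s hs, g2 s hs] at this

noncomputable def S0 : ℝ → ℝ := Real.smoothTransition
noncomputable def S1 : ℝ → ℝ := deriv S0
noncomputable def S2 : ℝ → ℝ := deriv S1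

lemma S0_cd : ContDiff ℝ (⊤ : ℕ∞) S0 := Real.smoothTransition.contDiff
lemma S1_cd : ContDiff ℝ (⊤ : ℕ∞) S1 := (contDiff_infty_iff_deriv.1 S0_cd).2
lemma S2_cd : ContDiff ℝ (⊤ : ℕ∞) S2 := (contDiff_infty_iff_deriv.1 S1_cd).2
lemma S0_d (x : ℝ) : HasDerivAt S0 (S1 x) x :=
  ((contDiff_infty_iff_deriv.1 S0_cd).1 x).hasDerivAt
lemma S1_d (x : ℝ) : HasDerivAt S1 (S2 x) x :=
  ((contDiff_infty_iff_deriv.1 S1_cd).1 x).hasDerivAt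
lemma S0_neg (x : ℝ) (h : x ≤ 0) : S0 x = 0 := Real.smoothTransition.zero_of_nonpos h
lemma S0_one (x : ℝ) (h : 1 ≤ x) : S0 x = 1 := Real.smoothTransition.one_of_one_le h
lemma S1_neg (x : ℝ) (h : x < 0) : S1 x = 0 := by
  have : S0 =ᶠ[𝓝 x] fun _ => 0 := by
    filter_upwards [Iio_mem_nhds h] with y hy using S0_neg y (le_of_lt hy)
  unfold S1; rw [this.deriv_eq]; simp
lemma S1_pos (x : ℝ) (h : 1 < x) : S1 x = 0 := by
  have : S0 =ᶠ[𝓝 x] fun _ => 1 := by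
    filter_upwards [Ioi_mem_nhds h] with y hy using S0_one y (le_of_lt hy)
  unfold S1; rw [this.deriv_eq]; simp
lemma S2_neg (x : ℝ) (h : x < 0) : S2 x = 0 := by
  have : S1 =ᶠ[𝓝 x] fun _ => 0 := by
    filter_upwards [Iio_mem_nhds h] with y hy using S1_neg y hy
  unfold S2; rw [this.deriv_eq]; simp
lemma S2_pos (x : ℝ) (h : 1 < x) : S2 x = 0 := by
  have : S1 =ᶠ[𝓝 x] fun _ => 0 := by
    filter_upwards [Ioi_mem_nhds h] with y hy using S1_pos y hy
  unfold S2; rw [this.deriv_eq]; simp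

lemma S_bound : ∃ K > 0, ∀ x, |S1 x| ≤ K ∧ |S2 x| ≤ K := by
  obtain ⟨K1, h1⟩ := isCompact_Icc.exists_bound_of_continuousOn
    (S1_cd.continuous.continuousOn (s := Icc 0 1))
  obtain ⟨K2, h2⟩ := isCompact_Icc.exists_bound_of_continuousOn
    (S2_cd.continuous.continuousOn (s := Icc 0 1))
  refine ⟨max 1 (max K1 K2), by positivity, fun x => ?_⟩
  by_cases hx : x ∈ Icc (0:ℝ) 1
  · exact ⟨(h1 x hx).trans (by simp), (h2 x hx).trans (by simp)⟩
  · have : x < 0 ∨ 1 < x := by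
      by_contra hc
      push Not at hc
      exact hx hc
    rcases this with h | h
    · rw [S1_neg x h, S2_neg x h]; simp
    · rw [S1_pos x h, S2_pos x h]; simp

/-- Taylor bounds at the right end point. -/
lemma taylor_bound (c b : ℝ) (w0 w1 w2 : ℝ → ℝ)
    (h0 : ∀ s ∈ Icc c b, HasDerivWithinAt w0 (w1 s) (Icc c b) s)
    (h1 : ∀ s ∈ Icc c b, HasDerivWithinAt w1 (w2 s) (Icc c b) s)
    (h2 : ContinuousOn w2 (Icc c b)) (e0 : w0 b = 0) (e1 : w1 b = 0) :
    ∃ M > 0, ∀ s ∈ Icc c b, |w0 s| ≤ M * (b - s) ^ 2 ∧ |w1 s| ≤ M * (b - s) := by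
  obtain ⟨M0, hM0⟩ := isCompact_Icc.exists_bound_of_continuousOn h2
  have A : ∀ s ∈ Icc c b, |w1 s| ≤ max 1 M0 * (b - s) := by
    intro s hs
    have hb : b ∈ Icc c b := ⟨hs.1.trans hs.2, le_rfl⟩
    have := (convex_Icc c b).norm_image_sub_le_of_norm_hasDerivWithin_le h1
      (fun x hx => (hM0 x hx).trans (le_max_right 1 M0)) hb hs
    rw [e1, sub_zero, Real.norm_eq_abs, Real.norm_eq_abs, abs_sub_comm,
      abs_of_nonneg (sub_nonneg.2 hs.2)] at this
    exact this
  refine ⟨max 1 M0, by positivity, fun s hs => ⟨?_, A s hs⟩⟩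
  have hsub : Icc s b ⊆ Icc c b := Icc_subset_Icc_left hs.1
  have := (convex_Icc s b).norm_image_sub_le_of_norm_hasDerivWithin_le
    (f := w0) (f' := w1) (C := max 1 M0 * (b - s)) (x := b) (y := s)
    (fun x hx => (h0 x (hsub hx)).mono hsub)
    (fun x hx => (A x (hsub hx)).trans (by
      apply mul_le_mul_of_nonneg_left _ (by positivity)
      linarith [hx.1])) ⟨hs.2, le_rfl⟩ ⟨le_rfl, hs.2⟩
  rw [e0, sub_zero, Real.norm_eq_abs, Real.norm_eq_abs, abs_sub_comm,
      abs_of_nonneg (sub_nonneg.2 hs.2)] at this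
  rw [pow_two, ← mul_assoc]
  exact this

lemma open_cond (Q σ u v m : ℝ) (hu : 0 < u) (hv : 0 < σ * v) (hm : m < RR Q u v) :
    ∃ r > 0, ∀ y0 y1 y2 : ℝ, |y0 - u| < r → |y1 - v| < r → y2 < m + r →
      0 < y0 ∧ 0 < σ * y1 ∧ y2 < RR Q y0 y1 := by
  obtain ⟨m', h1, h2⟩ := exists_between hm
  have E1 := (contAt_RR Q u v hu).eventually_const_lt h2
  have E2 : ∀ᶠ p : ℝ × ℝ in 𝓝 (u, v), 0 < p.1 :=
    continuous_fst.continuousAt.eventually_const_lt hu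
  have E3 : ∀ᶠ p : ℝ × ℝ in 𝓝 (u, v), 0 < σ * p.2 :=
    (continuous_const.mul continuous_snd).continuousAt.eventually_const_lt hv
  obtain ⟨r, hr, H⟩ := Metric.eventually_nhds_iff.1 (E1.and (E2.and E3))
  refine ⟨min r (m' - m), lt_min hr (by linarith), fun y0 y1 y2 a0 a1 a2 => ?_⟩
  have := @H (y0, y1) (by
    rw [Prod.dist_eq]
    exact max_lt (by simpa [Real.dist_eq] using a0.trans_le (min_le_left _ _))
      (by simpa [Real.dist_eq] using a1.trans_le (min_le_left _ _)))
  refine ⟨this.2.1, this.2.2, ?_⟩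
  have := this.1
  have := min_le_right r (m' - m)
  simp only at *
  linarith

lemma abs_mul_bd {a b A B : ℝ} (ha : |a| ≤ A) (hb : |b| ≤ B) : |a * b| ≤ A * B := by
  rw [abs_mul]
  exact mul_le_mul ha hb (abs_nonneg _) ((abs_nonneg _).trans ha)

/-- Logarithmic blending. -/
lemma blend (c b Q σ : ℝ) (hcb : c < b) (g0 g1 g2 B0 B1 B2 : ℝ → ℝ)
    (h0 : ∀ s ∈ Icc c b, HasDerivWithinAt g0 (g1 s) (Icc c b) s)
    (h1 : ∀ s ∈ Icc c b, HasDerivWithinAt g1 (g2 s) (Icc c b) s)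
    (h2 : ContinuousOn g2 (Icc c b))
    (k0 : ∀ s ∈ Icc c b, HasDerivWithinAt B0 (B1 s) (Icc c b) s)
    (k1 : ∀ s ∈ Icc c b, HasDerivWithinAt B1 (B2 s) (Icc c b) s)
    (k2 : ContinuousOn B2 (Icc c b))
    (e0 : B0 b = g0 b) (e1 : B1 b = g1 b)
    (hg : ∀ s ∈ Icc c b, 0 < g0 s ∧ 0 < σ * g1 s ∧ g2 s < RR Q (g0 s) (g1 s))
    (hB : B2 b < RR Q (g0 b) (g1 b)) (ρ : ℝ) (hρ : 0 < ρ) :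
    ∃ η > 0, Real.exp (-1 / η) < ρ ∧ ∀ s ∈ Ico c b, ∀ A, A = -1 - η * Real.log (b - s) →
      ∀ F0 F1 F2 : ℝ,
      F0 = g0 s + S0 A * (B0 s - g0 s) →
      F1 = g1 s + S0 A * (B1 s - g1 s) + η * S1 A / (b - s) * (B0 s - g0 s) →
      F2 = g2 s + S0 A * (B2 s - g2 s) + 2 * (η * S1 A / (b - s)) * (B1 s - g1 s)
        + (η ^ 2 * S2 A + η * S1 A) / (b - s) ^ 2 * (B0 s - g0 s) →
      0 < F0 ∧ 0 < σ * F1 ∧ F2 < RR Q F0 F1 := by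
  obtain ⟨M, hM, hw⟩ := taylor_bound c b (fun s => B0 s - g0 s) (fun s => B1 s - g1 s)
    (fun s => B2 s - g2 s) (fun s hs => (k0 s hs).sub (h0 s hs))
    (fun s hs => (k1 s hs).sub (h1 s hs)) (k2.sub h2) (by simp [e0]) (by simp [e1])
  obtain ⟨K, hK, hS⟩ := S_bound
  have hbm : b ∈ Icc c b := ⟨hcb.le, le_rfl⟩
  obtain ⟨r, hr, H⟩ := open_cond Q σ (g0 b) (g1 b) (max (g2 b) (B2 b)) (hg b hbm).1
    (hg b hbm).2.1 (max_lt (hg b hbm).2.2 hB)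
  have hnear : ∃ ρ₀ > 0, ∀ s ∈ Icc c b, b - s < ρ₀ → |g0 s - g0 b| < r / 2 ∧
      |g1 s - g1 b| < r / 2 ∧ g2 s < max (g2 b) (B2 b) + r / 2 ∧
      B2 s < max (g2 b) (B2 b) + r / 2 ∧ M * (b - s) ^ 2 < r / 2 ∧
      (M + K * M) * (b - s) < r / 2 := by
    have a0 := (h0 b hbm).continuousWithinAt
    have a1 := (h1 b hbm).continuousWithinAt
    have E0 : ∀ᶠ s in 𝓝[Icc c b] b, |g0 s - g0 b| < r / 2 :=
      (a0.sub continuousWithinAt_const).abs.eventually_lt_const (by simpa using hr)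
    have E1 : ∀ᶠ s in 𝓝[Icc c b] b, |g1 s - g1 b| < r / 2 :=
      (a1.sub continuousWithinAt_const).abs.eventually_lt_const (by simpa using hr)
    have E2 : ∀ᶠ s in 𝓝[Icc c b] b, g2 s < max (g2 b) (B2 b) + r / 2 :=
      (h2 b hbm).eventually_lt_const (by linarith [le_max_left (g2 b) (B2 b)])
    have E3 : ∀ᶠ s in 𝓝[Icc c b] b, B2 s < max (g2 b) (B2 b) + r / 2 :=
      (k2 b hbm).eventually_lt_const (by linarith [le_max_right (g2 b) (B2 b)])
    have E4 : ∀ᶠ s in 𝓝[Icc c b] b, M * (b - s) ^ 2 < r / 2 :=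
      (show Continuous fun s => M * (b - s) ^ 2 by fun_prop).continuousWithinAt.eventually_lt_const
        (by simpa using hr)
    have E5 : ∀ᶠ s in 𝓝[Icc c b] b, (M + K * M) * (b - s) < r / 2 :=
      (show Continuous fun s => (M + K * M) * (b - s) by
        fun_prop).continuousWithinAt.eventually_lt_const (by simpa using hr)
    have := E0.and (E1.and (E2.and (E3.and (E4.and E5))))
    rw [eventually_nhdsWithin_iff, Metric.eventually_nhds_iff] at this
    obtain ⟨ρ₀, p, q⟩ := this
    refine ⟨ρ₀, p, fun s hs hsb => q ?_ hs⟩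
    rw [Real.dist_eq, abs_sub_comm, abs_of_nonneg (sub_nonneg.2 hs.2)]
    exact hsb
  obtain ⟨ρ₀, hρ₀, N⟩ := hnear
  have hη : ∃ η > 0, η ≤ 1 ∧ Real.exp (-1 / η) < min ρ ρ₀ ∧ 4 * K * M * η < r / 2 := by
    have T1 : Tendsto (fun η : ℝ => Real.exp (-1 / η)) (𝓝[>] 0) (𝓝 0) := by
      apply Real.tendsto_exp_atBot.comp
      have : Tendsto (fun η : ℝ => -(η⁻¹)) (𝓝[>] 0) atBot :=
        tendsto_neg_atTop_atBot.comp tendsto_inv_nhdsGT_zero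
      refine this.congr fun x => by ring
    have E1 := T1.eventually_lt_const (lt_min hρ hρ₀)
    have E2 : ∀ᶠ η : ℝ in 𝓝[>] 0, 4 * K * M * η < r / 2 :=
      (show Continuous fun η => 4 * K * M * η by fun_prop).continuousWithinAt.eventually_lt_const
        (by simpa using hr)
    have E3 : ∀ᶠ η : ℝ in 𝓝[>] 0, η ≤ 1 := by
      have : ∀ᶠ η : ℝ in 𝓝[>] 0, η < 1 :=
        continuous_id.continuousWithinAt.eventually_lt_const (by simp)
      exact this.mono fun _ h => h.le
    obtain ⟨η, ⟨⟨p, q⟩, t⟩, v⟩ := (((E1.and E2).and E3).and self_mem_nhdsWithin).exists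
    exact ⟨η, v, t, p, q⟩
  obtain ⟨η, ηpos, η1, ηρ, ηr⟩ := hη
  refine ⟨η, ηpos, ηρ.trans_le (min_le_left _ _), ?_⟩
  intro s hs A hA F0 F1 F2 hF0 hF1 hF2
  have hs' : s ∈ Icc c b := ⟨hs.1, hs.2.le⟩
  have hx : 0 < b - s := by linarith [hs.2]
  by_cases hfar : ρ₀ ≤ b - s
  · have : A < 0 := by
      have h3 : -1 / η < Real.log (b - s) := by
        rw [Real.lt_log_iff_exp_lt hx]
        exact (ηρ.trans_le (min_le_right _ _)).trans_le hfar
      rw [div_lt_iff₀ ηpos] at h3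
      rw [hA]; linarith
    rw [S0_neg A this.le, S1_neg A this] at *
    rw [S2_neg A this] at *
    simp at hF0 hF1 hF2
    subst hF0 hF1 hF2
    exact hg s hs'
  · obtain ⟨n0, n1, n2, n3, n4, n5⟩ := N s hs' (not_le.1 hfar)
    obtain ⟨w0, w1⟩ := hw s hs'
    obtain ⟨t1, t2⟩ := hS A
    have s0 : 0 ≤ S0 A := Real.smoothTransition.nonneg A
    have s1 : S0 A ≤ 1 := Real.smoothTransition.le_one A
    have s01 : |S0 A| ≤ 1 := abs_le.2 ⟨by linarith, s1⟩
    have ηS : |η * S1 A / (b - s)| ≤ η * K / (b - s) := by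
      rw [abs_div, abs_of_pos hx, abs_mul, abs_of_pos ηpos]
      gcongr
    have ηSS : |(η ^ 2 * S2 A + η * S1 A) / (b - s) ^ 2| ≤ (2 * η * K) / (b - s) ^ 2 := by
      rw [abs_div, abs_of_pos (pow_pos hx 2)]
      gcongr
      calc |η ^ 2 * S2 A + η * S1 A| ≤ |η ^ 2 * S2 A| + |η * S1 A| := abs_add_le _ _
        _ ≤ η * K + η * K := by
            have : η ^ 2 ≤ η := by nlinarith
            rw [abs_mul, abs_mul, abs_of_pos ηpos, abs_of_pos (pow_pos ηpos 2)]
            gcongr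
        _ = _ := by ring
    have b1 := abs_mul_bd s01 w0
    have b2 := abs_mul_bd s01 w1
    have b3 := abs_mul_bd ηS w0
    have b4 := abs_mul_bd ηS w1
    have b5 := abs_mul_bd ηSS w0
    have c3 : η * K / (b - s) * (M * (b - s) ^ 2) = η * (K * M * (b - s)) := by
      field_simp
    have c4 : η * K / (b - s) * (M * (b - s)) = η * K * M := by
      field_simp
    have c5 : (2 * η * K) / (b - s) ^ 2 * (M * (b - s) ^ 2) = 2 * η * K * M := by
      field_simp
    rw [c3] at b3
    rw [c4] at b4
    rw [c5] at b5
    have b3' : η * (K * M * (b - s)) ≤ K * M * (b - s) :=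
      mul_le_of_le_one_left (by positivity) η1
    apply H
    · rw [abs_lt] at n0 ⊢
      rw [abs_le] at b1
      subst hF0
      constructor <;> linarith [b1.1, b1.2, n0.1, n0.2]
    · rw [abs_lt] at n1 ⊢
      rw [abs_le] at b2 b3
      subst hF1
      constructor <;> linarith [b2.1, b2.2, b3.1, b3.2, n1.1, n1.2]
    · have d1 : g2 s + S0 A * (B2 s - g2 s) ≤ max (g2 b) (B2 b) + r / 2 := by
        have : g2 s + S0 A * (B2 s - g2 s) = (1 - S0 A) * g2 s + S0 A * B2 s := by ring
        rw [this]
        have q1 := mul_le_mul_of_nonneg_left n2.le (sub_nonneg.2 s1)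
        have q2 := mul_le_mul_of_nonneg_left n3.le s0
        linarith
      rw [hF2]
      have d4 := (abs_le.1 b4).2
      have d5 := (abs_le.1 b5).2
      linarith

/-- Pointwise admissibility of a profile. -/
def Good (Q σ : ℝ) (h : ℝ → ℝ) (s : ℝ) : Prop :=
  0 < h s ∧ 0 < σ * deriv h s ∧ deriv (deriv h) s < RR Q (h s) (deriv h s)

lemma Good.congr {Q σ : ℝ} {h k : ℝ → ℝ} {s : ℝ} (H : Good Q σ h s) (e : k =ᶠ[𝓝 s] h) :
    Good Q σ k s := by
  unfold Good
  rw [e.deriv.deriv_eq, e.deriv_eq, e.eq_of_nhds]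
  exact H

lemma one_sided (a c b Q σ : ℝ) (hac : a < c) (hcb : c < b) (f B : ℝ → ℝ)
    (hf : ContDiffOn ℝ (⊤ : ℕ∞) f (Icc a b)) (hgood : ∀ s ∈ Icc a b, Good Q σ f s)
    (hB : ContDiff ℝ (⊤ : ℕ∞) B) (e0 : B b = f b) (e1 : deriv B b = deriv f b)
    (hB2 : deriv (deriv B) b < RR Q (f b) (deriv f b)) :
    ∃ (F : ℝ → ℝ) (c' d : ℝ), c < c' ∧ d < b ∧ (∀ s < c', F s = f s) ∧ (∀ s > d, F s = B s) ∧
      ∀ s ∈ Ioo a b, ContDiffAt ℝ (⊤ : ℕ∞) F s ∧ Good Q σ F s := by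
  have hab : a < b := hac.trans hcb
  have hu : UniqueDiffOn ℝ (Icc a b) := uniqueDiffOn_Icc hab
  set f1 := derivWithin f (Icc a b) with hf1
  set f2 := derivWithin f1 (Icc a b) with hf2
  obtain ⟨df, cf1⟩ := (contDiffOn_infty_iff_derivWithin hu).1 hf
  obtain ⟨df1, cf2⟩ := (contDiffOn_infty_iff_derivWithin hu).1 cf1
  have hd0 : ∀ s ∈ Icc a b, HasDerivWithinAt f (f1 s) (Icc a b) s :=
    fun s hs => (df s hs).hasDerivWithinAt
  have hd1 : ∀ s ∈ Icc a b, HasDerivWithinAt f1 (f2 s) (Icc a b) s :=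
    fun s hs => (df1 s hs).hasDerivWithinAt
  have hA0 : ∀ s ∈ Ioo a b, HasDerivAt f (f1 s) s :=
    fun s hs => (hd0 s ⟨hs.1.le, hs.2.le⟩).hasDerivAt (Icc_mem_nhds hs.1 hs.2)
  have hA1 : ∀ s ∈ Ioo a b, HasDerivAt f1 (f2 s) s :=
    fun s hs => (hd1 s ⟨hs.1.le, hs.2.le⟩).hasDerivAt (Icc_mem_nhds hs.1 hs.2)
  have hD0 : ∀ s ∈ Ioo a b, deriv f s = f1 s := fun s hs => (hA0 s hs).deriv
  have hD1 : ∀ s ∈ Ioo a b, deriv (deriv f) s = f2 s := by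
    intro s hs
    have : deriv f =ᶠ[𝓝 s] f1 := by
      filter_upwards [Ioo_mem_nhds hs.1 hs.2] with t ht using hD0 t ht
    rw [this.deriv_eq, (hA1 s hs).deriv]
  have hb : b ∈ Icc a b := ⟨hab.le, le_rfl⟩
  have hfb : f1 b = deriv f b := by
    have hne : deriv f b ≠ 0 := by
      intro h
      have := (hgood b hb).2.1
      rw [h] at this
      simp at this
    exact (differentiableAt_of_deriv_ne_zero hne).derivWithin (hu b hb)
  -- perturbation direction
  set k := (c + b) / 2 with hk
  have hck : c < k := by rw [hk]; linarith
  have hkb : k < b := by rw [hk]; linarith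
  have hkb' : 0 < b - k := by linarith
  set u : ℝ → ℝ := fun s => (s - k) / (b - k) with hudef
  have ud : ∀ s, HasDerivAt u (1 / (b - k)) s := fun s =>
    ((hasDerivAt_id s).sub_const k).div_const (b - k)
  have ub : u b = 1 := by simp [hudef, div_self hkb'.ne']
  set z0 : ℝ → ℝ := fun s => -((b - s) ^ 2 * S0 (u s)) with hz0
  set z1 : ℝ → ℝ := fun s => 2 * (b - s) * S0 (u s) - (b - s) ^ 2 * (S1 (u s) * (1 / (b - k)))
    with hz1
  set z2 : ℝ → ℝ := fun s => -2 * S0 (u s) + 4 * (b - s) * (S1 (u s) * (1 / (b - k)))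
    - (b - s) ^ 2 * (S2 (u s) * (1 / (b - k)) * (1 / (b - k))) with hz2
  have bd : ∀ s, HasDerivAt (fun s => b - s) (-1) s := fun s => by
    simpa using (hasDerivAt_id s).const_sub b
  have S0u : ∀ s, HasDerivAt (fun s => S0 (u s)) (S1 (u s) * (1 / (b - k))) s :=
    fun s => (S0_d (u s)).comp s (ud s)
  have S1u : ∀ s, HasDerivAt (fun s => S1 (u s)) (S2 (u s) * (1 / (b - k))) s :=
    fun s => (S1_d (u s)).comp s (ud s)
  have zd0 : ∀ s, HasDerivAt z0 (z1 s) s := by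
    intro s
    refine HasDerivAt.congr_deriv (((bd s).pow 2).mul (S0u s)).neg ?_
    simp [hz1]; ring
  have zd1 : ∀ s, HasDerivAt z1 (z2 s) s := by
    intro s
    refine HasDerivAt.congr_deriv ((((bd s).const_mul 2).mul (S0u s)).sub
      (((bd s).pow 2).mul ((S1u s).mul_const (1 / (b - k))))) ?_
    simp [hz2]; ring
  have cdu : ContDiff ℝ (⊤ : ℕ∞) u := by rw [hudef]; fun_prop
  have cS0 : ContDiff ℝ (⊤ : ℕ∞) (fun s => S0 (u s)) := S0_cd.comp cdu
  have cS1 : Continuous (fun s => S1 (u s)) := S1_cd.continuous.comp cdu.continuous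
  have cS2 : Continuous (fun s => S2 (u s)) := S2_cd.continuous.comp cdu.continuous
  have cS0' := cS0.continuous
  have cz0 : ContDiff ℝ (⊤ : ℕ∞) z0 := by rw [hz0]; fun_prop
  have cz1 : Continuous z1 := by rw [hz1]; fun_prop
  have cz2 : Continuous z2 := by rw [hz2]; fun_prop
  have hsub : Icc c b ⊆ Icc a b := Icc_subset_Icc_left hac.le
  have hP : ∀ s ∈ Ioo a b, PP Q (f s) (f1 s) (f2 s) < 0 := by
    intro s hs
    have := hgood s ⟨hs.1.le, hs.2.le⟩
    rw [Good, hD1 s hs, hD0 s hs] at this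
    exact (lt_RR_iff _ _ _ _ this.1).1 this.2.2
  have hPb : PP Q (f b) (f1 b) (f2 b) ≤ 0 := by
    have cP : ContinuousOn (fun s => PP Q (f s) (f1 s) (f2 s)) (Icc a b) := by
      have := hf.continuousOn
      have := cf1.continuousOn
      have := cf2.continuousOn
      unfold PP
      fun_prop
    have t : Tendsto (fun s => PP Q (f s) (f1 s) (f2 s)) (𝓝[Ioo a b] b)
      (𝓝 (PP Q (f b) (f1 b) (f2 b))) := (cP b hb).mono_left (nhdsWithin_mono _ Ioo_subset_Icc_self)
    have : (𝓝[Ioo a b] b).NeBot := by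
      rw [nhdsWithin_Ioo_eq_nhdsLT hab]; infer_instance
    exact le_of_tendsto t (by filter_upwards [self_mem_nhdsWithin] with s hs using (hP s hs).le)
  have mem : ∀ s ∈ Icc c b, s ≠ b → s ∈ Ioo a b := fun s hs h =>
    ⟨hac.trans_le hs.1, lt_of_le_of_ne hs.2 h⟩
  have hσ : ∀ s ∈ Icc c b, 0 < σ * f1 s := by
    intro s hs
    by_cases h : s = b
    · rw [h, hfb]; exact (hgood b hb).2.1
    · rw [← hD0 s (mem s hs h)]; exact (hgood s (hsub hs)).2.1
  obtain ⟨ε, hε, hpert⟩ := perturb c b Q σ hcb.le f f1 f2 z0 z1 z2 (hf.continuousOn.mono hsub)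
    (cf1.continuousOn.mono hsub) (cf2.continuousOn.mono hsub) cz0.continuous cz1 cz2
    (fun s hs => (hgood s (hsub hs)).1) hσ (fun s hs h => hP s (mem s hs h))
    (fun s hs => by
      by_cases h : s = b
      · rw [h]; exact hPb
      · exact (hP s (mem s hs h)).le)
    (by simp [hz0]) (by simp [hz1]) (by simp [hz2, ub, S0_one 1 le_rfl])
  set g0 : ℝ → ℝ := fun s => f s + ε * z0 s with hg0
  set g1 : ℝ → ℝ := fun s => f1 s + ε * z1 s with hg1
  set g2 : ℝ → ℝ := fun s => f2 s + ε * z2 s with hg2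
  obtain ⟨dB, cB1⟩ := contDiff_infty_iff_deriv.1 hB
  obtain ⟨dB1, cB2⟩ := contDiff_infty_iff_deriv.1 cB1
  have g0b : g0 b = f b := by simp [hg0, hz0]
  have g1b : g1 b = deriv f b := by simp [hg1, hz1, hfb]
  obtain ⟨η, hη, hηρ, hbl⟩ := blend c b Q σ hcb g0 g1 g2 B (deriv B) (deriv (deriv B))
    (fun s hs => ((hd0 s (hsub hs)).mono hsub).add (((zd0 s).const_mul ε).hasDerivWithinAt))
    (fun s hs => ((hd1 s (hsub hs)).mono hsub).add (((zd1 s).const_mul ε).hasDerivWithinAt))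
    ((cf2.continuousOn.mono hsub).add (continuous_const.mul cz2).continuousOn)
    (fun s _ => (dB s).hasDerivAt.hasDerivWithinAt)
    (fun s _ => (dB1 s).hasDerivAt.hasDerivWithinAt)
    cB2.continuous.continuousOn (by rw [e0, g0b]) (by rw [e1, g1b])
    (fun s hs => by
      have := hpert s hs
      exact ⟨this.1, this.2.1, (lt_RR_iff _ _ _ _ this.1).2 this.2.2⟩)
    (by rw [g0b, g1b]; exact hB2) (b - k) hkb'
  set A : ℝ → ℝ := fun s => -1 - η * Real.log (b - s) with hAdef
  set Fm : ℝ → ℝ := fun s => g0 s + S0 (A s) * (B s - g0 s) with hFm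
  set Fm1 : ℝ → ℝ := fun s => g1 s + S0 (A s) * (deriv B s - g1 s)
    + η * S1 (A s) / (b - s) * (B s - g0 s) with hFm1
  set F : ℝ → ℝ := fun s => if s < b then Fm s else B s with hF
  have hFf : ∀ s < k, F s = f s := by
    intro s hs
    have h1 : s < b := hs.trans hkb
    have hx : 0 < b - s := by linarith
    have h3 : -1 / η < Real.log (b - s) := by
      rw [Real.lt_log_iff_exp_lt hx]; linarith
    rw [div_lt_iff₀ hη] at h3
    have hA : A s ≤ 0 := by simp only [hAdef]; linarith
    have hu0 : u s ≤ 0 := div_nonpos_of_nonpos_of_nonneg (by linarith) hkb'.le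
    simp [hF, h1, hFm, hg0, hz0, S0_neg _ hA, S0_neg _ hu0]
  have hFB : ∀ s > b - Real.exp (-2 / η), F s = B s := by
    intro s hs
    by_cases h1 : s < b
    · have hx : 0 < b - s := by linarith
      have h3 : Real.log (b - s) < -2 / η := by
        rw [Real.log_lt_iff_lt_exp hx]; linarith
      rw [lt_div_iff₀ hη] at h3
      have hA : 1 ≤ A s := by simp only [hAdef]; linarith
      simp [hF, h1, hFm, S0_one _ hA]
    · simp [hF, h1]
  have hFe : ∀ s < b, F =ᶠ[𝓝 s] Fm := by
    intro s hs
    filter_upwards [Iio_mem_nhds hs] with t ht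
    simp only [hF, if_pos (show t < b from ht)]
  refine ⟨F, k, b - Real.exp (-2 / η), hck, by linarith [Real.exp_pos (-2 / η)], hFf, hFB, ?_⟩
  intro s hs
  constructor
  · refine ContDiffAt.congr_of_eventuallyEq ?_ (hFe s hs.2)
    have q1 : ContDiffAt ℝ (⊤ : ℕ∞) f s := hf.contDiffAt (Icc_mem_nhds hs.1 hs.2)
    have q2 : ContDiffAt ℝ (⊤ : ℕ∞) g0 s := q1.add (contDiffAt_const.mul cz0.contDiffAt)
    have q3 : ContDiffAt ℝ (⊤ : ℕ∞) A s :=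
      contDiffAt_const.sub (contDiffAt_const.mul
        ((contDiffAt_const.sub contDiffAt_id).log (by
          have := hs.2
          simp only [id]
          linarith)))
    have q4 : ContDiffAt ℝ (⊤ : ℕ∞) (fun s => S0 (A s)) s := S0_cd.contDiffAt.comp s q3
    exact q2.add (q4.mul (hB.contDiffAt.sub q2))
  · rcases lt_or_ge s c with hsc | hsc
    · refine (hgood s ⟨hs.1.le, hs.2.le⟩).congr ?_
      filter_upwards [Iio_mem_nhds (hsc.trans hck)] with t ht using hFf t ht
    · have dA : ∀ t ∈ Ioo a b, HasDerivAt A (η / (b - t)) t := by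
        intro t ht
        have hx : b - t ≠ 0 := by linarith [ht.2]
        refine HasDerivAt.congr_deriv ((((bd t).log hx).const_mul η).const_sub (-1)) ?_
        ring
      have dg0 : ∀ t ∈ Ioo a b, HasDerivAt g0 (g1 t) t := fun t ht =>
        (hA0 t ht).add ((zd0 t).const_mul ε)
      have dg1 : ∀ t ∈ Ioo a b, HasDerivAt g1 (g2 t) t := fun t ht =>
        (hA1 t ht).add ((zd1 t).const_mul ε)
      have dS0 : ∀ t ∈ Ioo a b, HasDerivAt (fun s => S0 (A s)) (S1 (A t) * (η / (b - t))) t :=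
        fun t ht => (S0_d (A t)).comp t (dA t ht)
      have dS1 : ∀ t ∈ Ioo a b, HasDerivAt (fun s => S1 (A s)) (S2 (A t) * (η / (b - t))) t :=
        fun t ht => (S1_d (A t)).comp t (dA t ht)
      have D1 : ∀ t ∈ Ioo a b, HasDerivAt Fm (Fm1 t) t := by
        intro t ht
        refine HasDerivAt.congr_deriv
          ((dg0 t ht).add ((dS0 t ht).mul ((dB t).hasDerivAt.sub (dg0 t ht)))) ?_
        simp only [hFm1]
        ring
      have hx : b - s ≠ 0 := by linarith [hs.2]
      have D2 : HasDerivAt Fm1 (g2 s + S0 (A s) * (deriv (deriv B) s - g2 s)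
          + 2 * (η * S1 (A s) / (b - s)) * (deriv B s - g1 s)
          + (η ^ 2 * S2 (A s) + η * S1 (A s)) / (b - s) ^ 2 * (B s - g0 s)) s := by
        refine HasDerivAt.congr_deriv
          (((dg1 s hs).add ((dS0 s hs).mul ((dB1 s).hasDerivAt.sub (dg1 s hs)))).add
          ((((dS1 s hs).const_mul η).div (bd s) hx).mul
            ((dB s).hasDerivAt.sub (dg0 s hs)))) ?_
        simp only [Pi.div_apply, Pi.sub_apply]
        field_simp
        ring
      have hdF : deriv F =ᶠ[𝓝 s] Fm1 := by
        filter_upwards [Ioo_mem_nhds hs.1 hs.2] with t ht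
        rw [(hFe t ht.2).deriv_eq, (D1 t ht).deriv]
      unfold Good
      rw [hdF.deriv_eq, D2.deriv, hdF.eq_of_nhds]
      have : F s = Fm s := (hFe s hs.2).eq_of_nhds
      rw [this]
      exact hbl s ⟨hsc, hs.2⟩ (A s) rfl _ _ _ rfl rfl rfl

lemma deriv_refl (h : ℝ → ℝ) : deriv (fun s => h (-s)) = fun s => -deriv h (-s) := by
  funext s
  exact deriv_comp_neg h s

lemma deriv2_refl (h : ℝ → ℝ) :
    deriv (deriv (fun s => h (-s))) = fun s => deriv (deriv h) (-s) := by
  funext s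
  rw [deriv_refl h]
  have : deriv (fun s => -deriv h (-s)) s = -deriv (fun s => deriv h (-s)) s := deriv.fun_neg
  rw [this, deriv_refl (deriv h)]
  simp

lemma Good.refl {Q σ : ℝ} {h : ℝ → ℝ} {s : ℝ} (H : Good Q σ h (-s)) :
    Good Q (-σ) (fun s => h (-s)) s := by
  obtain ⟨h0, h1, h2⟩ := H
  refine ⟨h0, ?_, ?_⟩
  · rw [deriv_refl]; simpa using h1
  · rw [deriv2_refl, deriv_refl]
    simpa [RR] using h2

lemma one_sided_right (a c b Q σ : ℝ) (hac : a < c) (hcb : c < b) (f B : ℝ → ℝ)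
    (hf : ContDiffOn ℝ (⊤ : ℕ∞) f (Icc a b)) (hgood : ∀ s ∈ Icc a b, Good Q σ f s)
    (hB : ContDiff ℝ (⊤ : ℕ∞) B) (e0 : B a = f a) (e1 : deriv B a = deriv f a)
    (hB2 : deriv (deriv B) a < RR Q (f a) (deriv f a)) :
    ∃ (F : ℝ → ℝ) (c' d : ℝ), c' < c ∧ a < d ∧ (∀ s > c', F s = f s) ∧ (∀ s < d, F s = B s) ∧
      ∀ s ∈ Ioo a b, ContDiffAt ℝ (⊤ : ℕ∞) F s ∧ Good Q σ F s := by
  obtain ⟨F, c', d, h1, h2, h3, h4, h5⟩ := one_sided (-b) (-c) (-a) Q (-σ) (by linarith)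
    (by linarith) (fun s => f (-s)) (fun s => B (-s))
    (hf.comp contDiff_neg.contDiffOn (fun s hs => ⟨by linarith [hs.2], by linarith [hs.1]⟩))
    (fun s hs => (hgood (-s) ⟨by linarith [hs.2], by linarith [hs.1]⟩).refl)
    (hB.comp contDiff_neg) (by simpa using e0) (by simp only [deriv_refl]; simpa using e1)
    (by
      rw [deriv2_refl, deriv_refl]
      simpa [RR] using hB2)
  refine ⟨fun s => F (-s), -c', -d, by linarith, by linarith, ?_, ?_, ?_⟩
  · intro s hs
    have := h3 (-s) (by linarith)
    simpa using this
  · intro s hs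
    have := h4 (-s) (by linarith)
    simpa using this
  · intro s hs
    obtain ⟨p, q⟩ := h5 (-s) ⟨by linarith [hs.2], by linarith [hs.1]⟩
    refine ⟨p.comp s contDiff_neg.contDiffAt, ?_⟩
    have := q.refl
    rwa [neg_neg] at this

lemma bridge_aux (θ : ℝ) (h0 : 0 < θ) (h1 : θ < 1) :
    ∃ (n : ℕ) (l : ℝ), 0 ≤ l ∧ l ≤ 1 ∧
      l * (1 / ((n : ℝ) + 2)) + (1 - l) * (1 - 1 / ((n : ℝ) + 2)) = θ := by
  obtain ⟨n, hn⟩ := exists_nat_one_div_lt (lt_min h0 (sub_pos.2 h1))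
  have hκ : 1 / ((n : ℝ) + 2) < min θ (1 - θ) := by
    refine lt_of_le_of_lt ?_ hn
    gcongr
    norm_num
  have a1 := hκ.trans_le (min_le_left _ _)
  have a2 := hκ.trans_le (min_le_right _ _)
  set κ := 1 / ((n : ℝ) + 2)
  have a3 : 0 < 1 - 2 * κ := by linarith
  refine ⟨n, (1 - κ - θ) / (1 - 2 * κ), div_nonneg (by linarith) a3.le, ?_, ?_⟩
  · rw [div_le_one a3]; linarith
  · have e := div_mul_cancel₀ (1 - κ - θ) a3.ne'
    linear_combination -e

lemma bridge (p q y z m1 m2 : ℝ) (hpq : p < q) (hm : m2 ≤ m1)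
    (t1 : m1 = m2 → (q - p) * m1 = z - y)
    (t2 : m2 < m1 → (q - p) * m2 < z - y ∧ z - y < (q - p) * m1) :
    ∃ B : ℝ → ℝ, ContDiff ℝ (⊤ : ℕ∞) B ∧ B p = y ∧ B q = z ∧ deriv B p = m1 ∧ deriv B q = m2 ∧
      ∀ s ∈ Icc p q, m2 ≤ deriv B s ∧ deriv B s ≤ m1 ∧ deriv (deriv B) s ≤ 0 := by
  have hl : 0 < q - p := by linarith
  have hθ : ∃ θ : ℝ, 0 < θ ∧ θ < 1 ∧ (q - p) * (m1 - (m1 - m2) * θ) = z - y := by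
    rcases hm.lt_or_eq with h | h
    · obtain ⟨u1, u2⟩ := t2 h
      have hd : 0 < (q - p) * (m1 - m2) := mul_pos hl (by linarith)
      refine ⟨((q - p) * m1 - (z - y)) / ((q - p) * (m1 - m2)), div_pos (by linarith) hd, ?_, ?_⟩
      · rw [div_lt_one hd]; linarith
      · have : m1 - m2 ≠ 0 := by linarith
        field_simp
        ring
    · refine ⟨1 / 2, by norm_num, by norm_num, ?_⟩
      rw [h, sub_self, zero_mul, sub_zero]
      exact t1 h.symm
  obtain ⟨θ, θ0, θ1, hθe⟩ := hθ
  obtain ⟨n, l, l0, l1, hle⟩ := bridge_aux θ θ0 θ1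
  set d := m1 - m2 with hd
  have hd0 : 0 ≤ d := by linarith
  set κ := 1 / ((n : ℝ) + 2) with hκ
  have hκn : κ * ((n : ℝ) + 2) = 1 := by rw [hκ]; field_simp
  set T : ℝ → ℝ := fun s => (s - p) / (q - p) with hT
  have Tp : T p = 0 := by simp [hT]
  have Tq : T q = 1 := by simp [hT, div_self hl.ne']
  have dT : ∀ s, HasDerivAt T (1 / (q - p)) s := fun s =>
    ((hasDerivAt_id s).sub_const p).div_const (q - p)
  have dT' : ∀ s, HasDerivAt (fun s => 1 - T s) (-(1 / (q - p))) s := fun s =>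
    (dT s).const_sub 1
  set B : ℝ → ℝ := fun s => y + (q - p) * (m1 * T s - d * (l * κ * T s ^ (n + 2)
    + (1 - l) * (T s + κ * ((1 - T s) ^ (n + 2) - 1)))) with hB
  set B1 : ℝ → ℝ := fun s => m1 - d * (l * T s ^ (n + 1) + (1 - l) * (1 - (1 - T s) ^ (n + 1)))
    with hB1
  have D0 : ∀ s, HasDerivAt B (B1 s) s := by
    intro s
    refine HasDerivAt.congr_deriv (((((dT s).const_mul m1).sub
      (((((dT s).pow (n + 2)).const_mul (l * κ)).add
        (((dT s).add ((((dT' s).pow (n + 2)).sub_const 1).const_mul κ)).const_mul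
          (1 - l))).const_mul d)).const_mul (q - p)).const_add y) ?_
    have e1 : n + 2 - 1 = n + 1 := rfl
    simp only [hB1, e1]
    push_cast
    have hlne := hl.ne'
    field_simp
    linear_combination (d * (l * (-(T s ^ (n + 1))) + (1 - l) * (1 - T s) ^ (n + 1))) * hκn
  have D1 : ∀ s, HasDerivAt B1 (-(d * ((n + 1) / (q - p) * (l * T s ^ n
      + (1 - l) * (1 - T s) ^ n)))) s := by
    intro s
    refine HasDerivAt.congr_deriv (((((((dT s).pow (n + 1)).const_mul l).add
        ((((dT' s).pow (n + 1)).const_sub 1).const_mul (1 - l))).const_mul d)).const_sub m1) ?_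
    have e1 : n + 1 - 1 = n := rfl
    simp only [e1]
    push_cast
    ring
  have hderiv : deriv B = B1 := funext fun s => (D0 s).deriv
  refine ⟨B, ?_, ?_, ?_, ?_, ?_, ?_⟩
  · have : ContDiff ℝ (⊤ : ℕ∞) T := by rw [hT]; fun_prop
    rw [hB]; fun_prop
  · simp [hB, Tp]
  · simp only [hB, Tq]
    simp
    linear_combination hθe + (-(q - p) * d) * hle
  · simp [hderiv, hB1, Tp]
  · simp [hderiv, hB1, Tq, hd]
  · intro s hs
    have T0 : 0 ≤ T s := div_nonneg (by linarith [hs.1]) hl.le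
    have T1 : T s ≤ 1 := by
      simp only [hT]
      rw [div_le_one hl]; linarith [hs.2]
    have U0 : 0 ≤ 1 - T s := by linarith
    have a1 : 0 ≤ T s ^ (n + 1) := pow_nonneg T0 _
    have a2 : T s ^ (n + 1) ≤ 1 := pow_le_one₀ T0 T1
    have a3 : 0 ≤ (1 - T s) ^ (n + 1) := pow_nonneg U0 _
    have a4 : (1 - T s) ^ (n + 1) ≤ 1 := pow_le_one₀ U0 (by linarith)
    have l2 : 0 ≤ 1 - l := by linarith
    have φ0 : 0 ≤ l * T s ^ (n + 1) + (1 - l) * (1 - (1 - T s) ^ (n + 1)) :=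
      add_nonneg (mul_nonneg l0 a1) (mul_nonneg l2 (by linarith))
    have φ1 : l * T s ^ (n + 1) + (1 - l) * (1 - (1 - T s) ^ (n + 1)) ≤ 1 := by
      have := mul_le_mul_of_nonneg_left a2 l0
      have := mul_le_mul_of_nonneg_left (show 1 - (1 - T s) ^ (n + 1) ≤ 1 by linarith) l2
      linarith
    rw [hderiv, (D1 s).deriv]
    refine ⟨?_, ?_, ?_⟩
    · have := mul_le_mul_of_nonneg_left φ1 hd0
      simp only [hB1]; linarith
    · have := mul_nonneg hd0 φ0
      simp only [hB1]; linarith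
    · rw [neg_nonpos]
      positivity

lemma RR_mono (Q Q₁ y0 y1 : ℝ) (h : 0 < y0) (hQ : Q ^ 2 ≤ Q₁ ^ 2) :
    RR Q₁ y0 y1 ≤ RR Q y0 y1 := by
  unfold RR
  gcongr

lemma RR_pos (Q Q₁ y m y0 y1 : ℝ) (hQ : Q ^ 2 ≤ Q₁ ^ 2) (h3a : y > |Q₁|)
    (h3b : 1 + Q₁ ^ 2 / y ^ 2 - 2 * |Q₁| / y > m ^ 2) (hy : y ≤ y0) (h0 : 0 < y1) (h1 : y1 ≤ m) :
    0 < RR Q y0 y1 := by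
  have hy0 : 0 < y := (abs_nonneg _).trans_lt h3a
  have hy0' : 0 < y0 := hy0.trans_le hy
  unfold RR
  apply mul_pos (by positivity)
  have a1 : y1 ^ 2 ≤ m ^ 2 := by gcongr
  have a2 : Q ^ 2 / y0 ^ 2 ≤ Q₁ ^ 2 / y ^ 2 := by gcongr
  have e1 : Q₁ ^ 2 / y ^ 2 = (|Q₁| / y) ^ 2 := by rw [div_pow, sq_abs]
  have e2 : 2 * |Q₁| / y = 2 * (|Q₁| / y) := by ring
  have q0 : 0 ≤ |Q₁| / y := by positivity
  have q1 : |Q₁| / y < 1 := by rw [div_lt_one hy0]; exact h3a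
  rw [e1, e2] at h3b
  rw [e1] at a2
  nlinarith

/-- Gluing Lemma 4.3 (n = 2) with the additional hypotheses `f₁' > 0`, `f₂' > 0`: the
bridging profile can moreover be chosen with `f' > 0`, so the resulting rotationally
symmetric manifold is foliated by mean convex spheres. -/
theorem stmt_2 (a₁ b₁ a₂ b₂ Q₁ Q₂ Q : ℝ)
    (hab₁ : a₁ < b₁) (hba : b₁ < a₂) (hab₂ : a₂ < b₂)
    (hQ : Q ^ 2 ≤ min (Q₁ ^ 2) (Q₂ ^ 2))
    (f₁ f₂ : ℝ → ℝ)
    (hf₁ : ContDiffOn ℝ (⊤ : ℕ∞) f₁ (Set.Icc a₁ b₁))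
    (hf₁pos : ∀ s ∈ Set.Icc a₁ b₁, 0 < f₁ s)
    (hf₂ : ContDiffOn ℝ (⊤ : ℕ∞) f₂ (Set.Icc a₂ b₂))
    (hf₂pos : ∀ s ∈ Set.Icc a₂ b₂, 0 < f₂ s)
    (hDEC₁ : ∀ s ∈ Set.Icc a₁ b₁,
      deriv (deriv f₁) s <
        (1 / (2 * f₁ s)) * (1 - (deriv f₁ s) ^ 2 - Q₁ ^ 2 / (f₁ s) ^ 2))
    (hDEC₂ : ∀ s ∈ Set.Icc a₂ b₂,
      deriv (deriv f₂) s <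
        (1 / (2 * f₂ s)) * (1 - (deriv f₂ s) ^ 2 - Q₂ ^ 2 / (f₂ s) ^ 2))
    (hval : f₁ b₁ < f₂ a₂)
    (hder : deriv f₂ a₂ ≤ deriv f₁ b₁)
    (h3a : f₁ b₁ > |Q₁|)
    (h3b : 1 + Q₁ ^ 2 / (f₁ b₁) ^ 2 - 2 * |Q₁| / f₁ b₁ > (deriv f₁ b₁) ^ 2)
    (h4a : f₂ a₂ > |Q₂|)
    (h4b : 1 + Q₂ ^ 2 / (f₂ a₂) ^ 2 - 2 * |Q₂| / f₂ a₂ > (deriv f₂ a₂) ^ 2)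
    (htrans₁ : deriv f₁ b₁ = deriv f₂ a₂ →
      (a₂ - b₁) * deriv f₁ b₁ = f₂ a₂ - f₁ b₁)
    (htrans₂ : deriv f₂ a₂ < deriv f₁ b₁ →
      (a₂ - b₁) * deriv f₂ a₂ < f₂ a₂ - f₁ b₁ ∧
        f₂ a₂ - f₁ b₁ < (a₂ - b₁) * deriv f₁ b₁)
    (hf₁' : ∀ s ∈ Set.Icc a₁ b₁, 0 < deriv f₁ s)
    (hf₂' : ∀ s ∈ Set.Icc a₂ b₂, 0 < deriv f₂ s) :
    ∃ f : ℝ → ℝ, ContDiffOn ℝ (⊤ : ℕ∞) f (Set.Icc a₁ b₂) ∧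
      (∀ s ∈ Set.Icc a₁ b₂, 0 < f s) ∧
      (∀ s ∈ Set.Icc a₁ ((a₁ + b₁) / 2), f s = f₁ s) ∧
      (∀ s ∈ Set.Icc ((a₂ + b₂) / 2) b₂, f s = f₂ s) ∧
      (∀ s ∈ Set.Icc a₁ b₂,
        deriv (deriv f) s <
          (1 / (2 * f s)) * (1 - (deriv f s) ^ 2 - Q ^ 2 / (f s) ^ 2)) ∧
      (∀ s ∈ Set.Icc a₁ b₂, 0 < deriv f s) := by
  have hQ1 : Q ^ 2 ≤ Q₁ ^ 2 := hQ.trans (min_le_left _ _)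
  have hQ2 : Q ^ 2 ≤ Q₂ ^ 2 := hQ.trans (min_le_right _ _)
  have G1 : ∀ s ∈ Icc a₁ b₁, Good Q 1 f₁ s := fun s hs =>
    ⟨hf₁pos s hs, by simpa using hf₁' s hs,
      (hDEC₁ s hs).trans_le (RR_mono Q Q₁ _ _ (hf₁pos s hs) hQ1)⟩
  have G2 : ∀ s ∈ Icc a₂ b₂, Good Q 1 f₂ s := fun s hs =>
    ⟨hf₂pos s hs, by simpa using hf₂' s hs,
      (hDEC₂ s hs).trans_le (RR_mono Q Q₂ _ _ (hf₂pos s hs) hQ2)⟩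
  obtain ⟨B, cB, Bp, Bq, dBp, dBq, hB⟩ := bridge b₁ a₂ (f₁ b₁) (f₂ a₂) (deriv f₁ b₁)
    (deriv f₂ a₂) hba hder htrans₁ htrans₂
  have hm2 : 0 < deriv f₂ a₂ := hf₂' a₂ ⟨le_rfl, hab₂.le⟩
  have hy : 0 < f₁ b₁ := hf₁pos b₁ ⟨hab₁.le, le_rfl⟩
  have Bmono : MonotoneOn B (Icc b₁ a₂) := by
    apply monotoneOn_of_deriv_nonneg (convex_Icc _ _) cB.continuous.continuousOn
      ((contDiff_infty_iff_deriv.1 cB).1.differentiableOn)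
    intro s hs
    exact hm2.le.trans (hB s (interior_subset hs)).1
  have GB : ∀ s ∈ Icc b₁ a₂, Good Q 1 B s := by
    intro s hs
    obtain ⟨p1, p2, p3⟩ := hB s hs
    have hle : f₁ b₁ ≤ B s := by
      rw [← Bp]; exact Bmono ⟨le_rfl, hba.le⟩ hs hs.1
    have hpos : 0 < deriv B s := hm2.trans_le p1
    exact ⟨hy.trans_le hle, by simpa using hpos,
      p3.trans_lt (RR_pos Q Q₁ (f₁ b₁) (deriv f₁ b₁) _ _ hQ1 h3a h3b hle hpos p2)⟩
  have GBp := GB b₁ ⟨le_rfl, hba.le⟩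
  have GBq := GB a₂ ⟨hba.le, le_rfl⟩
  obtain ⟨F, c₁, d₁, hc₁, hd₁, F1, F2, F3⟩ := one_sided a₁ ((a₁ + b₁) / 2) b₁ Q 1 (by linarith)
    (by linarith) f₁ B hf₁ G1 cB Bp dBp (by have := GBp.2.2; rwa [Bp, dBp] at this)
  obtain ⟨G, c₂, d₂, hc₂, hd₂, H1, H2, H3⟩ := one_sided_right a₂ ((a₂ + b₂) / 2) b₂ Q 1
    (by linarith) (by linarith) f₂ B hf₂ G2 cB Bq dBq (by have := GBq.2.2; rwa [Bq, dBq] at this)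
  set p := (b₁ + a₂) / 2 with hp
  have hp1 : b₁ < p := by rw [hp]; linarith
  have hp2 : p < a₂ := by rw [hp]; linarith
  set f : ℝ → ℝ := fun s => if s ≤ p then F s else G s with hf
  have eF : ∀ s < p, f s = F s := fun s hs => by simp only [hf, if_pos hs.le]
  have eG : ∀ s > p, f s = G s := fun s hs => by simp only [hf, if_neg (not_le.2 hs)]
  have eB : ∀ s, d₁ < s → s < d₂ → f s = B s := by
    intro s h1 h2
    by_cases h : s ≤ p
    · simp only [hf, if_pos h]; exact F2 s h1
    · simp only [hf, if_neg h]; exact H2 s h2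
  have lF : ∀ s < p, f =ᶠ[𝓝 s] F := fun s hs => by
    filter_upwards [Iio_mem_nhds hs] with t ht using eF t ht
  have lG : ∀ s > p, f =ᶠ[𝓝 s] G := fun s hs => by
    filter_upwards [Ioi_mem_nhds hs] with t ht using eG t ht
  have lB : ∀ s ∈ Icc b₁ a₂, f =ᶠ[𝓝 s] B := fun s hs => by
    filter_upwards [Ioo_mem_nhds (hd₁.trans_le hs.1) (hs.2.trans_lt hd₂)] with t ht
      using eB t ht.1 ht.2
  have la : f =ᶠ[𝓝 a₁] f₁ := by
    filter_upwards [Iio_mem_nhds (show a₁ < min c₁ p from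
      lt_min (by linarith) (by linarith))] with t ht
    rw [eF t (ht.trans_le (min_le_right _ _)), F1 t (ht.trans_le (min_le_left _ _))]
  have lb : f =ᶠ[𝓝 b₂] f₂ := by
    filter_upwards [Ioi_mem_nhds (show max c₂ p < b₂ from
      max_lt (by linarith) (by linarith))] with t ht
    rw [eG t ((le_max_right _ _).trans_lt ht), H1 t ((le_max_left _ _).trans_lt ht)]
  have cases : ∀ s ∈ Icc a₁ b₂, s = a₁ ∨ s = b₂ ∨ (s ∈ Ioo a₁ b₁ ∧ s < p) ∨
      (s ∈ Ioo a₂ b₂ ∧ s > p) ∨ s ∈ Icc b₁ a₂ := by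
    intro s hs
    rcases hs.1.eq_or_lt with h | h
    · exact Or.inl h.symm
    rcases hs.2.eq_or_lt with h' | h'
    · exact Or.inr (Or.inl h')
    rcases lt_or_ge s b₁ with h1 | h1
    · exact Or.inr (Or.inr (Or.inl ⟨⟨h, h1⟩, h1.trans hp1⟩))
    rcases le_or_gt s a₂ with h2 | h2
    · exact Or.inr (Or.inr (Or.inr (Or.inr ⟨h1, h2⟩)))
    · exact Or.inr (Or.inr (Or.inr (Or.inl ⟨⟨h2, h'⟩, hp2.trans h2⟩)))
  have good : ∀ s ∈ Icc a₁ b₂, Good Q 1 f s := by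
    intro s hs
    rcases cases s hs with h | h | ⟨h, h'⟩ | ⟨h, h'⟩ | h
    · subst h; exact (G1 s ⟨le_rfl, hab₁.le⟩).congr la
    · subst h; exact (G2 s ⟨hab₂.le, le_rfl⟩).congr lb
    · exact (F3 s h).2.congr (lF s h')
    · exact (H3 s h).2.congr (lG s h')
    · exact (GB s h).congr (lB s h)
  have smooth : ContDiffOn ℝ (⊤ : ℕ∞) f (Icc a₁ b₂) := by
    intro s hs
    rcases cases s hs with h | h | ⟨h, h'⟩ | ⟨h, h'⟩ | h
    · subst h
      have q : ContDiffWithinAt ℝ (⊤ : ℕ∞) f₁ (Icc s b₂) s :=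
        (hf₁ s ⟨le_rfl, hab₁.le⟩).mono_of_mem_nhdsWithin
          (mem_nhdsWithin.2 ⟨Iio b₁, isOpen_Iio, hab₁, fun t ht => ⟨ht.2.1, le_of_lt ht.1⟩⟩)
      exact q.congr_of_eventuallyEq (la.filter_mono nhdsWithin_le_nhds) la.eq_of_nhds
    · subst h
      have q : ContDiffWithinAt ℝ (⊤ : ℕ∞) f₂ (Icc a₁ s) s :=
        (hf₂ s ⟨hab₂.le, le_rfl⟩).mono_of_mem_nhdsWithin
          (mem_nhdsWithin.2 ⟨Ioi a₂, isOpen_Ioi, hab₂, fun t ht => ⟨le_of_lt ht.1, ht.2.2⟩⟩)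
      exact q.congr_of_eventuallyEq (lb.filter_mono nhdsWithin_le_nhds) lb.eq_of_nhds
    · exact ((F3 s h).1.congr_of_eventuallyEq (lF s h')).contDiffWithinAt
    · exact ((H3 s h).1.congr_of_eventuallyEq (lG s h')).contDiffWithinAt
    · exact (cB.contDiffAt.congr_of_eventuallyEq (lB s h)).contDiffWithinAt
  refine ⟨f, smooth, fun s hs => (good s hs).1, ?_, ?_, fun s hs => (good s hs).2.2, ?_⟩
  · intro s hs
    rw [eF s (by linarith [hs.2]), F1 s (by linarith [hs.2])]
  · intro s hs
    rw [eG s (by linarith [hs.1]), H1 s (by linarith [hs.1])]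
  · intro s hs
    simpa using (good s hs).2.1
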